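/- (Weighted partition of unity subordinate to interior parabolic cylinders) Let d ≥ 1 and p ∈ (1,∞). For every ε > 0 there exist a constant κ = κ(ε) ∈ (1/2,1), a constant N = N(d,p), and nonnegative functions η_k ∈ C^∞_0(ℝ × ℝ^d_+), k = 1,2,…, such that on ℝ × ℝ^d_+: (i) Σ_k η_k^p ≥ 1, Σ_k η_k ≤ N, and Σ_k ( x^1 |∇_x η_k| + (x^1)² |D²_x η_k| + (x^1)² |∂_t η_k| ) ≤ ε; and (ii) for each k, supp η_k ⊂ Q_k for some parabolic cylinder Q_k ∈ 𝔹(κ). -/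

import Mathlib

open MeasureTheory Set
open scoped ENNReal BigOperators

noncomputable section

abbrev Esp (d : ℕ) := EuclideanSpace ℝ (Fin d)

/-- The spatial half space `{x : x^1 > 0}`. -/
def halfSp (d : ℕ) [NeZero d] : Set (Esp d) := {x | 0 < x 0}

/-- The space-time half space `Ω = ℝ × ℝ^d_+`. -/
def halfST (d : ℕ) [NeZero d] : Set (ℝ × Esp d) := {z | 0 < z.2 0}

/-- The "slab" ball `𝓑_r(x) = (x^1-r, x^1+r) × B'_r(x')`. -/
def sball (d : ℕ) [NeZero d] (r : ℝ) (x : Esp d) : Set (Esp d) :=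
  {y | |y 0 - x 0| < r ∧ ∑ i ∈ Finset.univ.erase (0 : Fin d), (y i - x i) ^ 2 < r ^ 2}

/-- The parabolic cylinder `𝓠_r(t,x) = (t, t+r²) × 𝓑_r(x)`. -/
def pcyl (d : ℕ) [NeZero d] (r t : ℝ) (x : Esp d) : Set (ℝ × Esp d) :=
  Set.Ioo t (t + r ^ 2) ×ˢ sball d r x

/-- The weighted measure `ν(dx) = (x^1)^α dx` on the half space. -/
def nuW (d : ℕ) [NeZero d] (α : ℝ) : Measure (Esp d) :=
  ((volume : Measure (Esp d)).withDensity fun x => ENNReal.ofReal ((x 0) ^ α)).restrict (halfSp d)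

/-- The weighted measure `μ(dtdx) = (x^1)^α dx dt` on `Ω`. -/
def muW (d : ℕ) [NeZero d] (α : ℝ) : Measure (ℝ × Esp d) :=
  ((volume : Measure (ℝ × Esp d)).withDensity fun z => ENNReal.ofReal ((z.2 0) ^ α)).restrict
    (halfST d)

/-- Real-valued average of `g` over `S` with respect to `μ`. -/
def avgR {γ : Type*} [MeasurableSpace γ] (μ : Measure γ) (S : Set γ) (g : γ → ℝ) : ℝ :=
  (μ S).toReal⁻¹ * ∫ z in S, g z ∂μ

/-- `ℝ≥0∞`-valued average of a (nonnegative) function `g` over `S` with respect to `μ`. -/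
def eavg {γ : Type*} [MeasurableSpace γ] (μ : Measure γ) (S : Set γ) (g : γ → ℝ) : ℝ≥0∞ :=
  (μ S)⁻¹ * ∫⁻ z in S, ENNReal.ofReal (g z) ∂μ

/-- Time derivative `u_t`. -/
def ptime (d : ℕ) (u : ℝ × Esp d → ℝ) (z : ℝ × Esp d) : ℝ :=
  deriv (fun s => u (s, z.2)) z.1

/-- Spatial partial derivative `u_{x^i}`. -/
def psp (d : ℕ) [NeZero d] (i : Fin d) (u : ℝ × Esp d → ℝ) (z : ℝ × Esp d) : ℝ :=
  fderiv ℝ (fun y => u (z.1, y)) z.2 (EuclideanSpace.single i 1)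

/-- Norm of the spatial gradient `|u_x|`. -/
def gradNorm (d : ℕ) (u : ℝ × Esp d → ℝ) (z : ℝ × Esp d) : ℝ :=
  ‖fderiv ℝ (fun y => u (z.1, y)) z.2‖

/-- (Frobenius) norm of the spatial Hessian `|u_{xx}|`. -/
def hessNorm (d : ℕ) [NeZero d] (u : ℝ × Esp d → ℝ) (z : ℝ × Esp d) : ℝ :=
  Real.sqrt (∑ i, ∑ j, psp d i (psp d j u) z ^ 2)

/-- `|u_{xx}(w) - (u_{xx})_S|` where the mean of the Hessian over `S` is taken entrywise
with respect to `μ = muW d α`. -/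
def hessDiff (d : ℕ) [NeZero d] (α : ℝ) (u : ℝ × Esp d → ℝ) (S : Set (ℝ × Esp d))
    (w : ℝ × Esp d) : ℝ :=
  Real.sqrt (∑ i, ∑ j,
    (psp d i (psp d j u) w - avgR (muW d α) S (psp d i (psp d j u))) ^ 2)

/-- Partial derivative for functions of the space variable only. -/
def pspS (d : ℕ) [NeZero d] (i : Fin d) (v : Esp d → ℝ) (x : Esp d) : ℝ :=
  fderiv ℝ v x (EuclideanSpace.single i 1)

/-- Iterated spatial derivative `D^β u` along a list of coordinate directions. -/
def mderiv (d : ℕ) [NeZero d] : List (Fin d) → (ℝ × Esp d → ℝ) → ℝ × Esp d → ℝ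
  | [], u => u
  | i :: l, u => psp d i (mderiv d l u)

/-- Iterated derivative along a list of coordinate directions, spatial functions. -/
def mderivS (d : ℕ) [NeZero d] : List (Fin d) → (Esp d → ℝ) → Esp d → ℝ
  | [], v => v
  | i :: l, v => pspS d i (mderivS d l v)

/-- Uniform ellipticity for coefficients depending on `t` only. -/
def ellipT (d : ℕ) (A : ℝ → Fin d → Fin d → ℝ) (δ K : ℝ) : Prop :=
  ∀ (t : ℝ) (ξ : Fin d → ℝ),
    δ * ∑ i, ξ i ^ 2 ≤ ∑ i, ∑ j, A t i j * ξ i * ξ j ∧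
    ∑ i, ∑ j, A t i j * ξ i * ξ j ≤ K * ∑ i, ξ i ^ 2

/-- Uniform ellipticity for coefficients depending on `(t,x)`. -/
def ellipTX (d : ℕ) (A : ℝ × Esp d → Fin d → Fin d → ℝ) (δ K : ℝ) : Prop :=
  ∀ (z : ℝ × Esp d) (ξ : Fin d → ℝ),
    δ * ∑ i, ξ i ^ 2 ≤ ∑ i, ∑ j, A z i j * ξ i * ξ j ∧
    ∑ i, ∑ j, A z i j * ξ i * ξ j ≤ K * ∑ i, ξ i ^ 2

/-- `u ∈ C^∞_0(S)`: smooth, compactly supported, with support contained in `S`. -/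
def CinfC {E : Type*} [NormedAddCommGroup E] [NormedSpace ℝ E] (u : E → ℝ) (S : Set E) : Prop :=
  ContDiff ℝ (⊤ : ℕ∞) u ∧ HasCompactSupport u ∧ tsupport u ⊆ S

/-- Weighted parabolic maximal function `𝕄g`. -/
def maxFn (d : ℕ) [NeZero d] (α : ℝ) (g : ℝ × Esp d → ℝ) (z : ℝ × Esp d) : ℝ≥0∞ :=
  ⨆ (r : ℝ) (t : ℝ) (x : Esp d)
    (_ : 0 < r ∧ pcyl d r t x ⊆ halfST d ∧ z ∈ pcyl d r t x),
    ENNReal.ofReal (avgR (muW d α) (pcyl d r t x) fun w => |g w|)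

/-- Weighted parabolic sharp function `g^♯`. -/
def sharpFn (d : ℕ) [NeZero d] (α : ℝ) (g : ℝ × Esp d → ℝ) (z : ℝ × Esp d) : ℝ≥0∞ :=
  ⨆ (r : ℝ) (t : ℝ) (x : Esp d)
    (_ : 0 < r ∧ pcyl d r t x ⊆ halfST d ∧ z ∈ pcyl d r t x),
    ENNReal.ofReal (avgR (muW d α) (pcyl d r t x)
      fun w => |g w - avgR (muW d α) (pcyl d r t x) g|)

/-- Sharp function of the spatial Hessian `(u_{xx})^♯`. -/
def sharpHess (d : ℕ) [NeZero d] (α : ℝ) (u : ℝ × Esp d → ℝ) (z : ℝ × Esp d) : ℝ≥0∞ :=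
  ⨆ (r : ℝ) (t : ℝ) (x : Esp d)
    (_ : 0 < r ∧ pcyl d r t x ⊆ halfST d ∧ z ∈ pcyl d r t x),
    ENNReal.ofReal (avgR (muW d α) (pcyl d r t x) (hessDiff d α u (pcyl d r t x)))

/-- Weighted mean oscillation `osc^θ_x(a, 𝓠_r(t,x))` (Frobenius norm of matrix differences). -/
def oscWgt (d : ℕ) [NeZero d] (α : ℝ) (A : ℝ × Esp d → Fin d → Fin d → ℝ)
    (r t : ℝ) (x : Esp d) : ℝ :=
  (r ^ 2)⁻¹ * ∫ s in Set.Ioo t (t + r ^ 2),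
    avgR (nuW d α) (sball d r x) fun y =>
      avgR (nuW d α) (sball d r x) fun z =>
        Real.sqrt (∑ i, ∑ j, (A (s, y) i j - A (s, z) i j) ^ 2)

/-- Unweighted (Lebesgue) mean oscillation `osc_x(a, 𝓠_r(t,x))`. -/
def oscLeb (d : ℕ) [NeZero d] (A : ℝ × Esp d → Fin d → Fin d → ℝ)
    (r t : ℝ) (x : Esp d) : ℝ :=
  (r ^ 2)⁻¹ * ∫ s in Set.Ioo t (t + r ^ 2),
    avgR (volume : Measure (Esp d)) (sball d r x) fun y =>
      avgR (volume : Measure (Esp d)) (sball d r x) fun z =>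
        Real.sqrt (∑ i, ∑ j, (A (s, y) i j - A (s, z) i j) ^ 2)

/-- `𝓠_r(t,x) ∈ 𝔹(R,κ)`. -/
def inBQ (d : ℕ) [NeZero d] (R κ r t : ℝ) (x : Esp d) : Prop :=
  0 < x 0 ∧ 0 < r ∧ r ≤ κ * x 0 ∧ x 0 + r ≤ R

/-- `a^{#(θ)}_{R,κ}`, the supremum of weighted oscillations over `𝔹(R,κ)`. -/
def aSharp (d : ℕ) [NeZero d] (α R κ : ℝ) (A : ℝ × Esp d → Fin d → Fin d → ℝ) : ℝ :=
  sSup {v : ℝ | ∃ r t x, inBQ d R κ r t x ∧ v = oscWgt d α A r t x}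

/-- `a^{#(θ)}_κ = sup_{R>0} a^{#(θ)}_{R,κ}`. -/
def aSharpFull (d : ℕ) [NeZero d] (α κ : ℝ) (A : ℝ × Esp d → Fin d → Fin d → ℝ) : ℝ :=
  sSup {v : ℝ | ∃ (r t : ℝ) (x : Esp d), 0 < x 0 ∧ 0 < r ∧ r ≤ κ * x 0 ∧
    v = oscWgt d α A r t x}

/-- The weighted Sobolev-type norm `⟦v⟧^p = Σ_{|β| ≤ n} ∫ ((x^1)^{|β|}|D^β v|)^p (x^1)^{θ-d} dx`,
where mixed partial derivatives are enumerated by ordered tuples of directions. -/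
def wnorm (d : ℕ) [NeZero d] (p θ : ℝ) (n : ℕ) (v : Esp d → ℝ) : ℝ :=
  ∑ k ∈ Finset.range (n + 1), ∑ σ : Fin k → Fin d,
    ∫ x in halfSp d, ((x 0) ^ (k : ℝ) * |mderivS d (List.ofFn σ) v x|) ^ p * (x 0) ^ (θ - d)

/-- The cylinder `𝓠_r(a) = 𝓠_r(0,(a,0))`. -/
def cylA (d : ℕ) [NeZero d] (r aa : ℝ) : Set (ℝ × Esp d) :=
  pcyl d r 0 (EuclideanSpace.single (0 : Fin d) aa)

open Filter Topology

/-- The tensor product of a function of time and functions of the space coordinates. -/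
def tensorST (d : ℕ) (T : ℝ → ℝ) (F : Fin d → ℝ → ℝ) (z : ℝ × Esp d) : ℝ :=
  T z.1 * ∏ j, F j (z.2 j)

theorem contDiff_tensorST {d : ℕ} {T : ℝ → ℝ} {F : Fin d → ℝ → ℝ}
    (hT : ContDiff ℝ (⊤ : ℕ∞) T) (hF : ∀ j, ContDiff ℝ (⊤ : ℕ∞) (F j)) :
    ContDiff ℝ (⊤ : ℕ∞) (tensorST d T F) := by
  unfold tensorST
  refine (hT.comp contDiff_fst).mul (contDiff_prod fun j _ => (hF j).comp ?_)
  exact (EuclideanSpace.proj (𝕜 := ℝ) j).contDiff.comp contDiff_snd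

theorem psp_tensorST {d : ℕ} [NeZero d] (i : Fin d) (T : ℝ → ℝ) {F : Fin d → ℝ → ℝ}
    (hF : ∀ j, Differentiable ℝ (F j)) :
    psp d i (tensorST d T F) = tensorST d T (Function.update F i (deriv (F i))) := by
  funext z
  have hd : ∀ j ∈ Finset.univ, HasFDerivAt (fun y : Esp d => F j (y j))
      (deriv (F j) (z.2 j) • (EuclideanSpace.proj j : Esp d →L[ℝ] ℝ)) z.2 := fun j _ =>
    ((hF j (z.2 j)).hasDerivAt).comp_hasFDerivAt z.2
      (EuclideanSpace.proj (𝕜 := ℝ) j).hasFDerivAt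
  have h := (HasFDerivAt.finsetProd hd).const_mul (T z.1)
  unfold psp tensorST
  rw [h.fderiv]
  simp only [smul_apply, sum_apply, smul_eq_mul]
  congr 1
  rw [Finset.sum_eq_single i]
  · rw [← Finset.mul_prod_erase _ _ (Finset.mem_univ i)]
    simp only [Function.update_self]
    rw [mul_comm]
    congr 1
    · simp
    · refine Finset.prod_congr rfl fun j hj => ?_
      rw [Function.update_of_ne (Finset.ne_of_mem_erase hj)]
  · intro j _ hj
    simp [hj]
  · simp

theorem ptime_tensorST {d : ℕ} (T : ℝ → ℝ) (F : Fin d → ℝ → ℝ) (z : ℝ × Esp d) :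
    ptime d (tensorST d T F) z = tensorST d (deriv T) F z := by
  unfold ptime tensorST
  exact deriv_mul_const_field (u := T) (x := z.1) (∏ j, F j (z.2 j))

theorem gradNorm_le_sum {d : ℕ} [NeZero d] (u : ℝ × Esp d → ℝ) (z : ℝ × Esp d) :
    gradNorm d u z ≤ ∑ i, |psp d i u z| := by
  unfold gradNorm psp
  refine ContinuousLinearMap.opNorm_le_bound _ (Finset.sum_nonneg fun _ _ => abs_nonneg _) ?_
  intro v
  set A := fderiv ℝ (fun y => u (z.1, y)) z.2
  have hv : v = ∑ i, v i • EuclideanSpace.single i (1 : ℝ) := by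
    ext j
    simp [Finset.sum_apply, Pi.single_apply]
  conv_lhs => rw [hv]
  rw [map_sum, Finset.sum_mul]
  refine (norm_sum_le _ _).trans (Finset.sum_le_sum fun i _ => ?_)
  rw [map_smul, norm_smul, mul_comm]
  exact mul_le_mul_of_nonneg_left (PiLp.norm_apply_le v i) (abs_nonneg _)

theorem hessNorm_le_of_abs_le {d : ℕ} [NeZero d] {u : ℝ × Esp d → ℝ} {z : ℝ × Esp d} {B : ℝ}
    (hB : 0 ≤ B) (h : ∀ i j, |psp d i (psp d j u) z| ≤ B) : hessNorm d u z ≤ d * B := by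
  unfold hessNorm
  refine Real.sqrt_le_iff.2 ⟨by positivity, ?_⟩
  calc ∑ i, ∑ j, psp d i (psp d j u) z ^ 2 ≤ ∑ _i : Fin d, ∑ _j : Fin d, B ^ 2 :=
        Finset.sum_le_sum fun i _ => Finset.sum_le_sum fun j _ =>
          sq_le_sq' (abs_le.1 (h i j)).1 (abs_le.1 (h i j)).2
    _ = (d * B) ^ 2 := by simp; ring

theorem abs_tensorST_le {d : ℕ} {T : ℝ → ℝ} {F : Fin d → ℝ → ℝ} {z : ℝ × Esp d}
    {b : ℝ} (hT : |T z.1| ≤ b) (hF : ∀ j, |F j (z.2 j)| ≤ 1) :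
    |tensorST d T F z| ≤ b := by
  unfold tensorST
  rw [abs_mul, Finset.abs_prod]
  exact (mul_le_of_le_one_right (abs_nonneg _)
    (Finset.prod_le_one (fun _ _ => abs_nonneg _) fun j _ => hF j)).trans hT

theorem abs_tensorST_update_le {d : ℕ} {T : ℝ → ℝ} {F : Fin d → ℝ → ℝ} {z : ℝ × Esp d}
    {i : Fin d} {G : ℝ → ℝ} {b : ℝ} (hT : |T z.1| ≤ 1) (hF : ∀ j ≠ i, |F j (z.2 j)| ≤ 1)
    (hG : |G (z.2 i)| ≤ b) :
    |tensorST d T (Function.update F i G) z| ≤ b := by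
  unfold tensorST
  rw [abs_mul, ← Finset.mul_prod_erase _ _ (Finset.mem_univ i), abs_mul, Finset.abs_prod,
    Function.update_self]
  have h1 : ∏ j ∈ Finset.univ.erase i, |Function.update F i G j (z.2 j)| ≤ 1 := by
    refine Finset.prod_le_one (fun _ _ => abs_nonneg _) fun j hj => ?_
    rw [Function.update_of_ne (Finset.ne_of_mem_erase hj)]
    exact hF j (Finset.ne_of_mem_erase hj)
  exact (mul_le_of_le_one_left (by positivity) hT).trans
    ((mul_le_of_le_one_right (abs_nonneg _) h1).trans hG)

/-- Two derivatives of a tensor product, with a bound `b` on each first derivative. -/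
theorem abs_tensorST_update_update_le {d : ℕ} {T : ℝ → ℝ} {F : Fin d → ℝ → ℝ} {z : ℝ × Esp d}
    {i j : Fin d} (hij : i ≠ j) {G H : ℝ → ℝ} {b : ℝ} (hb : 0 ≤ b) (hT : |T z.1| ≤ 1)
    (hF : ∀ k, |F k (z.2 k)| ≤ 1) (hG : |G (z.2 j)| ≤ b) (hH : |H (z.2 i)| ≤ b) :
    |tensorST d T (Function.update (Function.update F j G) i H) z| ≤ b ^ 2 := by
  unfold tensorST
  rw [abs_mul, ← Finset.mul_prod_erase _ _ (Finset.mem_univ i),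
    ← Finset.mul_prod_erase _ _ (Finset.mem_erase.2 ⟨hij.symm, Finset.mem_univ j⟩),
    abs_mul, abs_mul, Finset.abs_prod, Function.update_self, Function.update_of_ne hij.symm,
    Function.update_self]
  have h1 : ∏ k ∈ (Finset.univ.erase i).erase j,
      |Function.update (Function.update F j G) i H k (z.2 k)| ≤ 1 := by
    refine Finset.prod_le_one (fun _ _ => abs_nonneg _) fun k hk => ?_
    rw [Finset.mem_erase, Finset.mem_erase] at hk
    rw [Function.update_of_ne hk.2.1, Function.update_of_ne hk.1]
    exact hF k
  refine (mul_le_of_le_one_left (by positivity) hT).trans ?_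
  rw [sq]
  exact mul_le_mul hH ((mul_le_of_le_one_right (abs_nonneg _) h1).trans hG) (by positivity) hb

/-- Weighted derivative bounds for a tensor product from one-dimensional ones. -/
theorem weighted_derivs_tensorST_le {d : ℕ} [NeZero d] {T : ℝ → ℝ} {F : Fin d → ℝ → ℝ}
    (hF : ∀ j, ContDiff ℝ (⊤ : ℕ∞) (F j)) {z : ℝ × Esp d} {w δ : ℝ} (hw : 0 < w)
    (hδ : 0 < δ) (hδ1 : δ ≤ 1) (hT0 : |T z.1| ≤ 1) (hT1 : w ^ 2 * |deriv T z.1| ≤ δ)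
    (hF0 : ∀ j, |F j (z.2 j)| ≤ 1) (hF1 : ∀ j, w * |deriv (F j) (z.2 j)| ≤ δ)
    (hF2 : ∀ j, w ^ 2 * |deriv (deriv (F j)) (z.2 j)| ≤ δ) :
    w * gradNorm d (tensorST d T F) z + w ^ 2 * hessNorm d (tensorST d T F) z
      + w ^ 2 * |ptime d (tensorST d T F) z| ≤ (2 * d + 1) * δ := by
  have hdiff : ∀ j, Differentiable ℝ (F j) := fun j => (hF j).differentiable (by simp)
  have hdiff' : ∀ j, Differentiable ℝ (deriv (F j)) := fun j =>
    ((contDiff_infty_iff_deriv.1 (hF j)).2).differentiable (by simp)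
  have hF1' : ∀ j, |deriv (F j) (z.2 j)| ≤ δ / w := fun j => by
    rw [le_div_iff₀ hw, mul_comm]; exact hF1 j
  have hF2' : ∀ j, |deriv (deriv (F j)) (z.2 j)| ≤ δ / w ^ 2 := fun j => by
    rw [le_div_iff₀ (by positivity), mul_comm]; exact hF2 j
  have hT1' : |deriv T z.1| ≤ δ / w ^ 2 := by
    rw [le_div_iff₀ (by positivity), mul_comm]; exact hT1
  have hgrad : gradNorm d (tensorST d T F) z ≤ d * (δ / w) := by
    refine (gradNorm_le_sum _ _).trans ((Finset.sum_le_sum fun i _ => ?_).trans_eq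
      (b := ∑ _i : Fin d, δ / w) (by simp))
    rw [psp_tensorST i T hdiff]
    exact abs_tensorST_update_le hT0 (fun j _ => hF0 j) (hF1' i)
  have hhess : hessNorm d (tensorST d T F) z ≤ d * (δ / w ^ 2) := by
    refine hessNorm_le_of_abs_le (by positivity) fun i j => ?_
    rw [psp_tensorST j T hdiff, psp_tensorST i T]
    · rcases eq_or_ne i j with rfl | hij
      · rw [Function.update_self, Function.update_idem]
        exact abs_tensorST_update_le hT0 (fun j _ => hF0 j) (hF2' i)
      · rw [Function.update_of_ne hij]
        refine (abs_tensorST_update_update_le hij (by positivity) hT0 hF0 (hF1' j)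
          (hF1' i)).trans ?_
        rw [div_pow]
        gcongr
        nlinarith
    · intro k
      rcases eq_or_ne k j with rfl | hkj
      · rw [Function.update_self]; exact hdiff' k
      · rw [Function.update_of_ne hkj]; exact hdiff k
  have htime : |ptime d (tensorST d T F) z| ≤ δ / w ^ 2 := by
    rw [ptime_tensorST]
    exact abs_tensorST_le hT1' hF0
  calc _ ≤ w * (d * (δ / w)) + w ^ 2 * (d * (δ / w ^ 2)) + w ^ 2 * (δ / w ^ 2) := by gcongr
    _ = (2 * d + 1) * δ := by field_simp; ring

theorem psp_eventuallyEq_zero {d : ℕ} [NeZero d] (i : Fin d) {u : ℝ × Esp d → ℝ}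
    {z : ℝ × Esp d} (h : u =ᶠ[𝓝 z] 0) : psp d i u =ᶠ[𝓝 z] 0 := by
  filter_upwards [h.eventually_nhds] with w hw
  have hs : (fun y => u (w.1, y)) =ᶠ[𝓝 w.2] fun _ => 0 :=
    (Continuous.prodMk_right w.1).tendsto w.2 |>.eventually hw
  simp [psp, hs.fderiv_eq]

/-- The weighted derivative expression vanishes off the topological support. -/
theorem weighted_derivs_eq_zero_of_notMem_tsupport {d : ℕ} [NeZero d] {u : ℝ × Esp d → ℝ}
    {z : ℝ × Esp d} (hz : z ∉ tsupport u) (w : ℝ) :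
    w * gradNorm d u z + w ^ 2 * hessNorm d u z + w ^ 2 * |ptime d u z| = 0 := by
  have h : u =ᶠ[𝓝 z] 0 := notMem_tsupport_iff_eventuallyEq.1 hz
  have hgrad : gradNorm d u z = 0 := by
    have hs : (fun y => u (z.1, y)) =ᶠ[𝓝 z.2] fun _ => 0 :=
      (Continuous.prodMk_right z.1).tendsto z.2 |>.eventually h
    simp [gradNorm, hs.fderiv_eq]
  have hhess : hessNorm d u z = 0 := by
    have : ∀ i j, psp d i (psp d j u) z = 0 := fun i j =>
      (psp_eventuallyEq_zero i (psp_eventuallyEq_zero j h)).self_of_nhds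
    simp [hessNorm, this]
  have htime : ptime d u z = 0 := by
    have hs : (fun s => u (s, z.2)) =ᶠ[𝓝 z.1] fun _ => 0 :=
      (Continuous.prodMk_left z.2).tendsto z.1 |>.eventually h
    simp [ptime, hs.deriv_eq]
  simp [hgrad, hhess, htime]

/-- A space-time box with prescribed sides. -/
def boxST (d : ℕ) (I : Set ℝ) (J : Fin d → Set ℝ) : Set (ℝ × Esp d) :=
  {z | z.1 ∈ I ∧ ∀ j, z.2 j ∈ J j}

theorem isCompact_boxST {d : ℕ} {I : Set ℝ} {J : Fin d → Set ℝ} (hI : IsCompact I)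
    (hJ : ∀ j, IsCompact (J j)) : IsCompact (boxST d I J) := by
  have h := hI.prod ((EuclideanSpace.equiv (Fin d) ℝ).toHomeomorph.isCompact_preimage.2
    (isCompact_univ_pi hJ))
  convert h using 1
  ext z
  simp [boxST]

theorem support_tensorST_subset {d : ℕ} {T : ℝ → ℝ} {F : Fin d → ℝ → ℝ} {I : Set ℝ}
    {J : Fin d → Set ℝ} (hT : Function.support T ⊆ I) (hF : ∀ j, Function.support (F j) ⊆ J j) :
    Function.support (tensorST d T F) ⊆ boxST d I J := by
  intro z hz
  have hz' := mul_ne_zero_iff.1 (Function.mem_support.1 hz)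
  exact ⟨hT hz'.1, fun j => hF j ((Finset.prod_ne_zero_iff.1 hz'.2) j (Finset.mem_univ j))⟩

theorem tsum_le_card_mul_of_eq_zero_off {ι : Type*} {f : ι → ℝ≥0∞} {S : Finset ι} {M : ℕ}
    {B : ℝ≥0∞} (hS : S.card ≤ M) (h0 : ∀ i ∉ S, f i = 0) (hB : ∀ i ∈ S, f i ≤ B) :
    ∑' i, f i ≤ M * B := by
  rw [tsum_eq_sum h0]
  refine (Finset.sum_le_card_nsmul S f B hB).trans ?_
  rw [nsmul_eq_mul]
  gcongr

/-- A smooth bump on the line, equal to one on `[-1/2, 1/2]` and supported in `[-3/4, 3/4]`. -/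
def lineBump : ContDiffBump (0 : ℝ) := ⟨1 / 2, 3 / 4, by norm_num, by norm_num⟩

theorem lineBump_eq_one {s : ℝ} (hs : |s| ≤ 1 / 2) : lineBump s = 1 :=
  lineBump.one_of_mem_closedBall (by simpa [lineBump] using hs)

theorem abs_le_of_lineBump_ne_zero {s : ℝ} (hs : lineBump s ≠ 0) : |s| ≤ 3 / 4 := by
  by_contra! h
  exact hs (lineBump.zero_of_le_dist (by simpa [lineBump] using h.le))

theorem abs_lineBump_le_one (s : ℝ) : |lineBump s| ≤ 1 := by
  rw [abs_of_nonneg lineBump.nonneg]; exact lineBump.le_one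

theorem contDiff_lineBump : ContDiff ℝ (⊤ : ℕ∞) lineBump := lineBump.contDiff

theorem contDiff_deriv_lineBump : ContDiff ℝ (⊤ : ℕ∞) (deriv lineBump) :=
  (contDiff_infty_iff_deriv.1 contDiff_lineBump).2

theorem exists_bound_deriv_lineBump :
    ∃ C : ℝ, 1 ≤ C ∧ (∀ s, |deriv lineBump s| ≤ C) ∧ ∀ s, |deriv (deriv lineBump) s| ≤ C := by
  obtain ⟨A, hA⟩ := contDiff_deriv_lineBump.continuous.bounded_above_of_compact_support
    lineBump.hasCompactSupport.deriv
  obtain ⟨B, hB⟩ := (contDiff_infty_iff_deriv.1 contDiff_deriv_lineBump).2.continuous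
    |>.bounded_above_of_compact_support lineBump.hasCompactSupport.deriv.deriv
  exact ⟨max 1 (max A B), le_max_left _ _,
    fun s => (hA s).trans ((le_max_left _ _).trans (le_max_right _ _)),
    fun s => (hB s).trans ((le_max_right _ _).trans (le_max_right _ _))⟩

/-- The rescaled bump at the lattice point `b * m`. -/
def scaledBump (b : ℝ) (m : ℤ) (y : ℝ) : ℝ := lineBump (y / b - m)

theorem contDiff_scaledBump (b : ℝ) (m : ℤ) : ContDiff ℝ (⊤ : ℕ∞) (scaledBump b m) :=
  contDiff_lineBump.comp ((contDiff_id.div_const b).sub contDiff_const)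

theorem hasDerivAt_comp_div_sub {g : ℝ → ℝ} (hg : Differentiable ℝ g) (b m y : ℝ) :
    HasDerivAt (fun y => g (y / b - m)) (deriv g (y / b - m) / b) y := by
  have h := (hg (y / b - m)).hasDerivAt.comp y (((hasDerivAt_id y).div_const b).sub_const m)
  simpa [div_eq_mul_inv, Function.comp_def] using h

theorem deriv_scaledBump (b : ℝ) (m : ℤ) :
    deriv (scaledBump b m) = fun y => deriv lineBump (y / b - m) / b :=
  funext fun y =>
    (hasDerivAt_comp_div_sub (contDiff_lineBump.differentiable (by simp)) b m y).deriv

theorem deriv_deriv_scaledBump (b : ℝ) (m : ℤ) :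
    deriv (deriv (scaledBump b m)) = fun y => deriv (deriv lineBump) (y / b - m) / b / b := by
  rw [deriv_scaledBump]
  exact funext fun y => ((hasDerivAt_comp_div_sub
    (contDiff_deriv_lineBump.differentiable (by simp)) b m y).div_const b).deriv

theorem support_scaledBump_subset {b : ℝ} (hb : 0 < b) (m : ℤ) :
    Function.support (scaledBump b m) ⊆ Icc (b * (m - 3 / 4)) (b * (m + 3 / 4)) := by
  intro y hy
  have h := abs_le.1 (abs_le_of_lineBump_ne_zero hy)
  have hy' : y = b * (y / b) := by field_simp
  constructor <;> rw [hy'] <;> gcongr <;> linarith [h.1, h.2]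

/-- A bump in the logarithmic variable, vanishing on the nonpositive half line. -/
def logBump (L : ℝ) (n : ℤ) (y : ℝ) : ℝ := if 0 < y then lineBump (Real.log y / L - n) else 0

theorem logBump_of_pos (L : ℝ) (n : ℤ) {y : ℝ} (hy : 0 < y) :
    logBump L n y = lineBump (Real.log y / L - n) := if_pos hy

theorem logBump_eventuallyEq (L : ℝ) (n : ℤ) {y : ℝ} (hy : 0 < y) :
    logBump L n =ᶠ[𝓝 y] fun y => lineBump (Real.log y / L - n) := by
  filter_upwards [lt_mem_nhds hy] with s hs using logBump_of_pos L n hs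

theorem support_logBump_subset {L : ℝ} (hL : 0 < L) (n : ℤ) :
    Function.support (logBump L n) ⊆
      Icc (Real.exp (L * (n - 3 / 4))) (Real.exp (L * (n + 3 / 4))) := by
  intro y hy
  have hy0 : 0 < y := by
    by_contra h
    exact hy (if_neg h)
  rw [Function.mem_support, logBump_of_pos L n hy0] at hy
  have h := abs_le.1 (abs_le_of_lineBump_ne_zero hy)
  have hy' : Real.log y = L * (Real.log y / L) := by field_simp
  constructor
  · rw [← Real.le_log_iff_exp_le hy0, hy']
    gcongr
    linarith [h.1]
  · rw [← Real.log_le_iff_le_exp hy0, hy']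
    gcongr
    linarith [h.2]

theorem contDiff_logBump {L : ℝ} (hL : 0 < L) (n : ℤ) :
    ContDiff ℝ (⊤ : ℕ∞) (logBump L n) := by
  refine contDiff_iff_contDiffAt.2 fun y => ?_
  rcases lt_or_ge 0 y with hy | hy
  · refine ContDiffAt.congr_of_eventuallyEq ?_ (logBump_eventuallyEq L n hy)
    exact contDiff_lineBump.contDiffAt.comp y
      (((Real.contDiffAt_log.2 hy.ne').div_const L).sub contDiffAt_const)
  · have h : logBump L n =ᶠ[𝓝 y] fun _ => 0 := by
      filter_upwards [gt_mem_nhds (hy.trans_lt (Real.exp_pos (L * (n - 3 / 4))))] with s hs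
      by_contra hne
      exact absurd (support_logBump_subset hL n hne).1 (not_le.2 hs)
    exact contDiffAt_const.congr_of_eventuallyEq h

theorem hasDerivAt_comp_log_div_sub {g : ℝ → ℝ} (hg : Differentiable ℝ g) (L m : ℝ) {y : ℝ}
    (hy : 0 < y) :
    HasDerivAt (fun y => g (Real.log y / L - m)) (deriv g (Real.log y / L - m) / (L * y)) y := by
  have h := (hg (Real.log y / L - m)).hasDerivAt.comp y
    (((Real.hasDerivAt_log hy.ne').div_const L).sub_const m)
  refine h.congr_deriv ?_
  simp only [div_eq_mul_inv, mul_inv]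
  ring

theorem deriv_logBump (L : ℝ) (n : ℤ) {y : ℝ} (hy : 0 < y) :
    deriv (logBump L n) y = deriv lineBump (Real.log y / L - n) / (L * y) := by
  rw [(logBump_eventuallyEq L n hy).deriv_eq]
  exact (hasDerivAt_comp_log_div_sub (contDiff_lineBump.differentiable (by simp)) L n hy).deriv

theorem deriv_deriv_logBump {L : ℝ} (hL : 0 < L) (n : ℤ) {y : ℝ} (hy : 0 < y) :
    deriv (deriv (logBump L n)) y =
      (deriv (deriv lineBump) (Real.log y / L - n) / L
        - deriv lineBump (Real.log y / L - n)) / (L * y ^ 2) := by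
  have h : deriv (logBump L n) =ᶠ[𝓝 y]
      fun y => deriv lineBump (Real.log y / L - n) / (L * y) := by
    filter_upwards [lt_mem_nhds hy] with s hs using deriv_logBump L n hs
  rw [h.deriv_eq]
  have h1 := (hasDerivAt_comp_log_div_sub
    (contDiff_deriv_lineBump.differentiable (by simp)) L n hy).div
    ((hasDerivAt_id y).const_mul L) (by simp [hy.ne', hL.ne'])
  refine h1.deriv.trans ?_
  simp only [id]
  field_simp

theorem abs_logBump_le_one (L : ℝ) (n : ℤ) (y : ℝ) : |logBump L n y| ≤ 1 := by
  unfold logBump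
  split_ifs
  · exact abs_lineBump_le_one _
  · simp

/-- The length scale of the layer `x^1 ∼ exp (L * n)`. -/
def layerScale (K L : ℝ) (n : ℤ) : ℝ := K * Real.exp (L * (n + 1))

theorem layerScale_pos {K : ℝ} (hK : 0 < K) (L : ℝ) (n : ℤ) : 0 < layerScale K L n := by
  unfold layerScale; positivity

/-- The factor in the `i`-th space variable of the bump with lattice index `m`. -/
def spaceBump (d : ℕ) [NeZero d] (c K L : ℝ) (m : Fin d → ℤ) (i : Fin d) : ℝ → ℝ :=
  if i = 0 then logBump L (m 0) else scaledBump (c * layerScale K L (m 0)) (m i)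

/-- The bump in the layer `m.2 0` located at the remaining lattice coordinates of `m`. -/
def cylBump (d : ℕ) [NeZero d] (c K L : ℝ) (m : ℤ × (Fin d → ℤ)) : ℝ × Esp d → ℝ :=
  tensorST d (scaledBump (c * layerScale K L (m.2 0) ^ 2) m.1) (spaceBump d c K L m.2)

/-- The closed interval containing the support of `spaceBump`. -/
def spaceSide (d : ℕ) [NeZero d] (c K L : ℝ) (m : Fin d → ℤ) (i : Fin d) : Set ℝ :=
  if i = 0 then Icc (Real.exp (L * (m 0 - 3 / 4))) (Real.exp (L * (m 0 + 3 / 4)))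
  else Icc (c * layerScale K L (m 0) * (m i - 3 / 4)) (c * layerScale K L (m 0) * (m i + 3 / 4))

/-- The compact box containing the support of `cylBump`. -/
def cylBox (d : ℕ) [NeZero d] (c K L : ℝ) (m : ℤ × (Fin d → ℤ)) : Set (ℝ × Esp d) :=
  boxST d (Icc (c * layerScale K L (m.2 0) ^ 2 * (m.1 - 3 / 4))
    (c * layerScale K L (m.2 0) ^ 2 * (m.1 + 3 / 4))) (spaceSide d c K L m.2)

theorem isCompact_cylBox (d : ℕ) [NeZero d] (c K L : ℝ) (m : ℤ × (Fin d → ℤ)) :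
    IsCompact (cylBox d c K L m) := by
  refine isCompact_boxST isCompact_Icc fun j => ?_
  unfold spaceSide
  split_ifs <;> exact isCompact_Icc

section

variable {d : ℕ} [NeZero d] {c K L : ℝ}

theorem tsupport_cylBump_subset (hc : 0 < c) (hK : 0 < K) (hL : 0 < L)
    (m : ℤ × (Fin d → ℤ)) : tsupport (cylBump d c K L m) ⊆ cylBox d c K L m := by
  have hA := layerScale_pos hK L (m.2 0)
  refine closure_minimal (support_tensorST_subset (support_scaledBump_subset (by positivity) _)
    fun j => ?_) (isCompact_cylBox d c K L m).isClosed
  unfold spaceBump spaceSide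
  split_ifs
  · exact support_logBump_subset hL _
  · exact support_scaledBump_subset (by positivity) _

theorem contDiff_spaceBump (hL : 0 < L) (m : Fin d → ℤ) (i : Fin d) :
    ContDiff ℝ (⊤ : ℕ∞) (spaceBump d c K L m i) := by
  unfold spaceBump
  split_ifs
  · exact contDiff_logBump hL _
  · exact contDiff_scaledBump _ _

theorem abs_spaceBump_le_one (m : Fin d → ℤ) (i : Fin d) (y : ℝ) :
    |spaceBump d c K L m i y| ≤ 1 := by
  unfold spaceBump
  split_ifs
  · exact abs_logBump_le_one _ _ _
  · exact abs_lineBump_le_one _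

theorem cylBump_nonneg (m : ℤ × (Fin d → ℤ)) (z : ℝ × Esp d) : 0 ≤ cylBump d c K L m z := by
  unfold cylBump tensorST
  refine mul_nonneg lineBump.nonneg (Finset.prod_nonneg fun j _ => ?_)
  unfold spaceBump
  split_ifs
  · unfold logBump
    split_ifs
    · exact lineBump.nonneg
    · exact le_rfl
  · exact lineBump.nonneg

theorem cylBump_le_one (m : ℤ × (Fin d → ℤ)) (z : ℝ × Esp d) : cylBump d c K L m z ≤ 1 :=
  (le_abs_self _).trans
    (abs_tensorST_le (abs_lineBump_le_one _) fun _ => abs_spaceBump_le_one _ _ _)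

theorem exists_cylBump_eq_one {z : ℝ × Esp d} (hz : 0 < z.2 0) :
    ∃ m, cylBump d c K L m z = 1 := by
  set n := round (Real.log (z.2 0) / L)
  refine ⟨(round (z.1 / (c * layerScale K L n ^ 2)), fun i =>
    if i = 0 then n else round (z.2 i / (c * layerScale K L n))), ?_⟩
  unfold cylBump tensorST
  rw [Finset.prod_eq_one, mul_one]
  · simpa [scaledBump] using lineBump_eq_one (abs_sub_round _)
  · intro i _
    unfold spaceBump
    split_ifs with hi
    · subst hi
      simpa [logBump_of_pos _ _ hz] using lineBump_eq_one (abs_sub_round _)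
    · simpa [scaledBump, hi] using lineBump_eq_one (abs_sub_round _)

theorem exists_fin_two_eq_floor_add {b y : ℝ} {m : ℤ} (hb : 0 < b)
    (hy : y ∈ Icc (b * (m - 3 / 4)) (b * (m + 3 / 4))) :
    ∃ e : Fin 2, m = ⌊y / b⌋ + ((e : ℕ) : ℤ) := by
  have h1 : (m : ℝ) - 3 / 4 ≤ y / b := by rw [le_div_iff₀ hb, mul_comm]; exact hy.1
  have h2 : y / b ≤ m + 3 / 4 := by rw [div_le_iff₀ hb, mul_comm]; exact hy.2
  have h3 : ⌊y / b⌋ ≤ m := Int.lt_add_one_iff.1 (Int.floor_lt.2 (by push_cast; linarith))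
  have h4 : m - 1 ≤ ⌊y / b⌋ := Int.le_floor.2 (by push_cast; linarith)
  rcases (show m = ⌊y / b⌋ ∨ m = ⌊y / b⌋ + 1 by omega) with h | h
  · exact ⟨0, by simpa using h⟩
  · exact ⟨1, by simpa using h⟩

/-- The boxes have bounded overlap, independently of the scales. -/
theorem exists_finset_cylBox (hc : 0 < c) (hK : 0 < K) (hL : 0 < L) (z : ℝ × Esp d) :
    ∃ S : Finset (ℤ × (Fin d → ℤ)), S.card ≤ 2 ^ (d + 1) ∧ ∀ m ∉ S, z ∉ cylBox d c K L m := by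
  classical
  let n : (Fin d → Fin 2) → ℤ := fun e => ⌊Real.log (z.2 0) / L⌋ + ((e 0 : ℕ) : ℤ)
  let dec : Fin 2 × (Fin d → Fin 2) → ℤ × (Fin d → ℤ) := fun e =>
    (⌊z.1 / (c * layerScale K L (n e.2) ^ 2)⌋ + ((e.1 : ℕ) : ℤ), fun i =>
      if i = 0 then n e.2
      else ⌊z.2 i / (c * layerScale K L (n e.2))⌋ + ((e.2 i : ℕ) : ℤ))
  refine ⟨Finset.univ.image dec, Finset.card_image_le.trans ?_, ?_⟩
  · simp [pow_succ, mul_comm]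
  · intro m hm hz
    refine hm (Finset.mem_image.2 ?_)
    have hA := layerScale_pos hK L (m.2 0)
    obtain ⟨e₀, he₀⟩ := exists_fin_two_eq_floor_add (by positivity) hz.1
    have hs : ∀ i, ∃ e : Fin 2, m.2 i = (if i = 0 then ⌊Real.log (z.2 0) / L⌋
        else ⌊z.2 i / (c * layerScale K L (m.2 0))⌋) + ((e : ℕ) : ℤ) := by
      intro i
      have hi := hz.2 i
      unfold spaceSide at hi
      split_ifs at hi ⊢ with h0
      · subst h0
        have hpos : 0 < z.2 0 := (Real.exp_pos _).trans_le hi.1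
        exact exists_fin_two_eq_floor_add hL
          ⟨(Real.le_log_iff_exp_le hpos).2 hi.1, (Real.log_le_iff_le_exp hpos).2 hi.2⟩
      · exact exists_fin_two_eq_floor_add (by positivity) hi
    choose e he using hs
    have hn : n e = m.2 0 := by rw [he 0, if_pos rfl]
    refine ⟨(e₀, e), Finset.mem_univ _, Prod.ext ?_ (funext fun i => ?_)⟩
    · simp only [dec, hn]; exact he₀.symm
    · simp only [dec, hn]
      split_ifs with h0
      · rw [h0]
      · rw [he i, if_neg h0]

theorem weighted_derivs_cylBump_le {C δ : ℝ} (hc : 0 < c) (hc1 : c ≤ 1) (hC : 1 ≤ C)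
    (hC1 : ∀ s, |deriv lineBump s| ≤ C) (hC2 : ∀ s, |deriv (deriv lineBump) s| ≤ C)
    (hδ : 0 < δ) (hδ1 : δ ≤ 1) (hK : K = C / (c ^ 2 * δ)) (hL : L = 2 * C / δ)
    {m : ℤ × (Fin d → ℤ)} {z : ℝ × Esp d} (hz : z ∈ cylBox d c K L m) :
    z.2 0 * gradNorm d (cylBump d c K L m) z + z.2 0 ^ 2 * hessNorm d (cylBump d c K L m) z
      + z.2 0 ^ 2 * |ptime d (cylBump d c K L m) z| ≤ (2 * d + 1) * δ := by
  have hC0 : 0 < C := by linarith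
  have hK0 : 0 < K := by rw [hK]; positivity
  have hL0 : 0 < L := by rw [hL]; positivity
  have hLδ : C / L ≤ δ / 2 := by rw [hL]; apply le_of_eq; field_simp
  have hL1 : 1 ≤ L := by
    rw [hL, le_div_iff₀ hδ]; linarith
  have hKδ : C / (c ^ 2 * K) = δ := by rw [hK]; field_simp
  have hK1 : 1 ≤ K := by
    rw [hK, le_div_iff₀ (by positivity), one_mul]
    nlinarith [mul_le_one₀ (pow_le_one₀ hc.le hc1 : c ^ 2 ≤ 1) hδ.le hδ1]
  have hA := layerScale_pos hK0 L (m.2 0)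
  set A := layerScale K L (m.2 0) with hAdef
  have hz0 := hz.2 0
  simp only [spaceSide, if_true] at hz0
  have hw : 0 < z.2 0 := (Real.exp_pos _).trans_le hz0.1
  have hwA : z.2 0 ≤ A / K := by
    rw [hAdef, layerScale, mul_div_cancel_left₀ _ hK0.ne']
    refine hz0.2.trans (Real.exp_le_exp.2 ?_)
    gcongr
    norm_num
  have hcK : C / (c * K) ≤ δ := by
    rw [← hKδ]
    gcongr
    nlinarith
  have hcK2 : C / (c ^ 2 * K ^ 2) ≤ δ := by
    rw [← hKδ]
    gcongr
    nlinarith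
  have hcK' : C / (c * K ^ 2) ≤ δ := by
    refine le_trans ?_ hcK
    gcongr
    nlinarith
  refine weighted_derivs_tensorST_le (fun j => contDiff_spaceBump hL0 _ _) hw hδ hδ1
    (abs_lineBump_le_one _) ?_ (fun _ => abs_spaceBump_le_one _ _ _) (fun j => ?_) fun j => ?_
  · rw [deriv_scaledBump, abs_div, abs_of_pos (show 0 < c * A ^ 2 by positivity)]
    calc z.2 0 ^ 2 * (|deriv lineBump (z.1 / (c * A ^ 2) - m.1)| / (c * A ^ 2))
        ≤ (A / K) ^ 2 * (C / (c * A ^ 2)) := by gcongr; exact hC1 _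
      _ = C / (c * K ^ 2) := by field_simp
      _ ≤ δ := hcK'
  · unfold spaceBump
    split_ifs with h0
    · subst h0
      rw [deriv_logBump _ _ hw, abs_div, abs_of_pos (show 0 < L * z.2 0 by positivity)]
      calc z.2 0 * (|deriv lineBump (Real.log (z.2 0) / L - m.2 0)| / (L * z.2 0))
          ≤ z.2 0 * (C / (L * z.2 0)) := by gcongr; exact hC1 _
        _ = C / L := by field_simp
        _ ≤ δ := by linarith
    · rw [deriv_scaledBump, abs_div, abs_of_pos (show 0 < c * A by positivity)]
      calc z.2 0 * (|deriv lineBump (z.2 j / (c * A) - m.2 j)| / (c * A))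
          ≤ (A / K) * (C / (c * A)) := by gcongr; exact hC1 _
        _ = C / (c * K) := by field_simp
        _ ≤ δ := hcK
  · unfold spaceBump
    split_ifs with h0
    · subst h0
      rw [deriv_deriv_logBump hL0 _ hw, abs_div,
        abs_of_pos (show 0 < L * z.2 0 ^ 2 by positivity)]
      have hnum : |deriv (deriv lineBump) (Real.log (z.2 0) / L - m.2 0) / L
          - deriv lineBump (Real.log (z.2 0) / L - m.2 0)| ≤ 2 * C := by
        refine (abs_sub _ _).trans ?_
        rw [abs_div, abs_of_pos hL0]
        have := (div_le_self (abs_nonneg _) hL1).trans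
          (hC2 (Real.log (z.2 0) / L - m.2 0))
        linarith [hC1 (Real.log (z.2 0) / L - m.2 0)]
      calc _ ≤ z.2 0 ^ 2 * (2 * C / (L * z.2 0 ^ 2)) := by gcongr
        _ = 2 * (C / L) := by field_simp
        _ ≤ δ := by linarith
    · rw [deriv_deriv_scaledBump, abs_div, abs_div, abs_of_pos (show 0 < c * A by positivity)]
      calc z.2 0 ^ 2 * (|deriv (deriv lineBump) (z.2 j / (c * A) - m.2 j)| / (c * A) / (c * A))
          ≤ (A / K) ^ 2 * (C / (c * A) / (c * A)) := by gcongr; exact hC2 _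
        _ = C / (c ^ 2 * K ^ 2) := by field_simp
        _ ≤ δ := hcK2

theorem cylBox_subset_halfST (m : ℤ × (Fin d → ℤ)) : cylBox d c K L m ⊆ halfST d := by
  intro z hz
  have hz0 := hz.2 0
  simp only [spaceSide, if_true] at hz0
  exact (Real.exp_pos _).trans_le hz0.1

/-- Each box lies in a cylinder of `𝔹(κ)` for `κ` close to one. -/
theorem exists_cylBox_subset_pcyl {κ : ℝ} (hc : c = 1 / (16 * d)) (hK : 1 ≤ K) (hL : 0 < L)
    (hκ : 1 / 2 < κ) (hκL : κ = 1 - Real.exp (-(2 * L)) / (2 * K)) (m : ℤ × (Fin d → ℤ)) :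
    ∃ (r t : ℝ) (x : Esp d), 0 < x 0 ∧ 0 < r ∧ r ≤ κ * x 0 ∧
      cylBox d c K L m ⊆ pcyl d r t x := by
  have hK0 : 0 < K := by linarith
  have hA := layerScale_pos hK0 L (m.2 0)
  set A := layerScale K L (m.2 0) with hAdef
  have hd : (1 : ℝ) ≤ d := by exact_mod_cast NeZero.one_le
  have hc0 : 0 < c := by rw [hc]; positivity
  have hcd : c * d = 1 / 16 := by rw [hc]; field_simp
  have hc16 : c ≤ 1 / 16 := by nlinarith
  have hκ0 : 0 < κ := by linarith
  have hr2 : A ^ 2 / 4 ≤ (κ * A) ^ 2 := by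
    rw [mul_pow]
    nlinarith [sq_nonneg A, show 1 / 4 ≤ κ ^ 2 by nlinarith]
  refine ⟨κ * A, c * A ^ 2 * m.1 - (κ * A) ^ 2 / 2,
    WithLp.toLp 2 fun i => if i = 0 then A else c * A * m.2 i, by simpa using hA, by positivity,
    by simp, ?_⟩
  intro z hz
  have hA2 : 0 < A ^ 2 := by positivity
  have hcA : c * A ^ 2 ≤ 1 / 16 * A ^ 2 := by gcongr
  refine ⟨⟨?_, ?_⟩, ?_, ?_⟩
  · have := hz.1.1
    nlinarith
  · have := hz.1.2
    nlinarith
  · have hz0 := hz.2 0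
    simp only [spaceSide, if_true] at hz0
    have hlow : A - κ * A < z.2 0 := by
      have h1 : A - κ * A = Real.exp (L * (m.2 0 - 1)) / 2 := by
        rw [hκL, hAdef, layerScale,
          show L * ((m.2 0 : ℝ) - 1) = L * (m.2 0 + 1) + -(2 * L) by ring, Real.exp_add]
        field_simp
        ring
      have h2 : Real.exp (L * (m.2 0 - 1)) ≤ Real.exp (L * (m.2 0 - 3 / 4)) := by
        refine Real.exp_le_exp.2 ?_
        gcongr
        norm_num
      linarith [hz0.1, Real.exp_pos (L * (m.2 0 - 1))]
    have hup : z.2 0 ≤ A := by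
      have h1 : Real.exp (L * (m.2 0 + 3 / 4)) ≤ Real.exp (L * (m.2 0 + 1)) := by
        refine Real.exp_le_exp.2 ?_
        gcongr
        norm_num
      have h2 : Real.exp (L * (m.2 0 + 1)) ≤ A := le_mul_of_one_le_left (Real.exp_pos _).le hK
      exact hz0.2.trans (h1.trans h2)
    simp only [if_true]
    rw [abs_lt]
    constructor
    · linarith
    · nlinarith
  · have hside : ∀ i ∈ Finset.univ.erase (0 : Fin d),
        (z.2 i - (WithLp.toLp 2 fun i => if i = 0 then A else c * A * m.2 i : Esp d) i) ^ 2
          ≤ (c * A) ^ 2 := by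
      intro i hi
      have hi0 := Finset.ne_of_mem_erase hi
      have hzi := hz.2 i
      simp only [spaceSide, hi0, if_false] at hzi
      have hcA0 : 0 < c * A := by positivity
      simp only [hi0, if_false]
      refine sq_le_sq' ?_ ?_
      · linarith [hzi.1]
      · linarith [hzi.2]
    refine (Finset.sum_le_card_nsmul _ _ _ hside).trans_lt ?_
    rw [nsmul_eq_mul]
    have hcard : (((Finset.univ.erase (0 : Fin d)).card : ℕ) : ℝ) ≤ d := by
      exact_mod_cast (Finset.card_le_univ _).trans_eq (Fintype.card_fin d)
    calc _ ≤ (d : ℝ) * (c * A) ^ 2 := by gcongr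
      _ = (c * d) * (c * A ^ 2) := by ring
      _ < (κ * A) ^ 2 := by rw [hcd]; nlinarith

end

/-- **Weighted partition of unity subordinate to interior parabolic cylinders.** -/
theorem stmt16 (d : ℕ) [NeZero d] (p : ℝ) (hp : 1 < p) :
    ∃ N : ℝ, 0 < N ∧
      ∀ ε : ℝ, 0 < ε → ∃ κ ∈ Set.Ioo (1 / 2 : ℝ) 1,
      ∃ η : ℕ → ℝ × Esp d → ℝ,
        (∀ k, ContDiff ℝ (⊤ : ℕ∞) (η k) ∧ HasCompactSupport (η k) ∧
          tsupport (η k) ⊆ halfST d ∧ ∀ z, 0 ≤ η k z) ∧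
        (∀ z ∈ halfST d,
          (1 : ℝ≥0∞) ≤ ∑' k, ENNReal.ofReal (η k z ^ p) ∧
          (∑' k, ENNReal.ofReal (η k z)) ≤ ENNReal.ofReal N ∧
          (∑' k, ENNReal.ofReal
              (z.2 0 * gradNorm d (η k) z + (z.2 0) ^ 2 * hessNorm d (η k) z
                + (z.2 0) ^ 2 * |ptime d (η k) z|)) ≤ ENNReal.ofReal ε) ∧
        (∀ k, ∃ (r t : ℝ) (x : Esp d), 0 < x 0 ∧ 0 < r ∧ r ≤ κ * x 0 ∧
          tsupport (η k) ⊆ pcyl d r t x) := by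
  obtain ⟨C, hC, hC1, hC2⟩ := exists_bound_deriv_lineBump
  have hd : (1 : ℝ) ≤ d := by exact_mod_cast NeZero.one_le
  refine ⟨2 ^ (d + 1), by positivity, fun ε hε => ?_⟩
  obtain ⟨c, hc⟩ : ∃ c : ℝ, c = 1 / (16 * d) := ⟨_, rfl⟩
  have hc0 : 0 < c := by rw [hc]; positivity
  have hc1 : c ≤ 1 := by rw [hc, div_le_one (by positivity)]; linarith
  obtain ⟨δ, hδ⟩ : ∃ δ : ℝ, δ = min 1 (ε / (2 ^ (d + 1) * (2 * d + 1))) := ⟨_, rfl⟩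
  have hδ0 : 0 < δ := by rw [hδ]; positivity
  have hδ1 : δ ≤ 1 := by rw [hδ]; exact min_le_left _ _
  have hδε : 2 ^ (d + 1) * ((2 * d + 1) * δ) ≤ ε := by
    have := hδ.trans_le (min_le_right _ _)
    rw [le_div_iff₀ (by positivity)] at this
    linarith
  obtain ⟨K, hK⟩ : ∃ K : ℝ, K = C / (c ^ 2 * δ) := ⟨_, rfl⟩
  obtain ⟨L, hL⟩ : ∃ L : ℝ, L = 2 * C / δ := ⟨_, rfl⟩
  have hK1 : 1 ≤ K := by
    rw [hK, le_div_iff₀ (by positivity), one_mul]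
    exact (mul_le_one₀ (pow_le_one₀ hc0.le hc1) hδ0.le hδ1).trans hC
  have hK0 : 0 < K := by linarith
  have hL0 : 0 < L := by rw [hL]; positivity
  obtain ⟨κ, hκ⟩ : ∃ κ : ℝ, κ = 1 - Real.exp (-(2 * L)) / (2 * K) := ⟨_, rfl⟩
  have hexp : Real.exp (-(2 * L)) / (2 * K) < 1 / 2 := by
    rw [div_lt_div_iff₀ (by positivity) (by norm_num)]
    have : Real.exp (-(2 * L)) < 1 := Real.exp_zero ▸ Real.exp_lt_exp.2 (by linarith)
    linarith
  have hexp0 : 0 < Real.exp (-(2 * L)) / (2 * K) := by positivity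
  have hκ2 : 1 / 2 < κ := by linarith
  obtain ⟨e⟩ : Nonempty (ℕ ≃ ℤ × (Fin d → ℤ)) := by
    obtain ⟨_⟩ := nonempty_denumerable (ℤ × (Fin d → ℤ))
    exact ⟨(Denumerable.eqv _).symm⟩
  have hsupp : ∀ m, tsupport (cylBump d c K L m) ⊆ cylBox d c K L m :=
    tsupport_cylBump_subset hc0 hK0 hL0
  refine ⟨κ, ⟨hκ2, by linarith⟩, fun k => cylBump d c K L (e k), fun k => ⟨?_, ?_, ?_, ?_⟩,
    fun z hz => ?_, fun k => ?_⟩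
  · exact contDiff_tensorST (contDiff_scaledBump _ _) fun j => contDiff_spaceBump hL0 _ _
  · exact (isCompact_cylBox d c K L (e k)).of_isClosed_subset (isClosed_tsupport _) (hsupp _)
  · exact (hsupp _).trans (cylBox_subset_halfST _)
  · exact cylBump_nonneg _
  · obtain ⟨S, hScard, hS⟩ := exists_finset_cylBox hc0 hK0 hL0 z
    have hS' : ∀ m ∉ S, z ∉ tsupport (cylBump d c K L m) := fun m hm h => hS m hm (hsupp m h)
    refine ⟨?_, ?_, ?_⟩
    · obtain ⟨m, hm⟩ := exists_cylBump_eq_one (c := c) (K := K) (L := L) hz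
      refine le_trans ?_ (ENNReal.le_tsum (e.symm m))
      simp [hm]
    · rw [e.tsum_eq fun m => ENNReal.ofReal (cylBump d c K L m z)]
      refine (tsum_le_card_mul_of_eq_zero_off hScard (B := 1) (fun m hm => ?_)
        fun m _ => ?_).trans_eq ?_
      · rw [image_eq_zero_of_notMem_tsupport (hS' m hm), ENNReal.ofReal_zero]
      · exact ENNReal.ofReal_le_one.2 (cylBump_le_one m z)
      · rw [mul_one, ENNReal.ofReal_pow (by norm_num)]
        simp
    · rw [e.tsum_eq fun m => ENNReal.ofReal (z.2 0 * gradNorm d (cylBump d c K L m) z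
        + z.2 0 ^ 2 * hessNorm d (cylBump d c K L m) z
        + z.2 0 ^ 2 * |ptime d (cylBump d c K L m) z|)]
      refine (tsum_le_card_mul_of_eq_zero_off hScard
        (B := ENNReal.ofReal ((2 * d + 1) * δ)) (fun m hm => ?_) fun m _ => ?_).trans ?_
      · rw [weighted_derivs_eq_zero_of_notMem_tsupport (hS' m hm), ENNReal.ofReal_zero]
      · refine ENNReal.ofReal_le_ofReal ?_
        by_cases hm : z ∈ cylBox d c K L m
        · exact weighted_derivs_cylBump_le hc0 hc1 hC hC1 hC2 hδ0 hδ1 hK hL hm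
        · rw [weighted_derivs_eq_zero_of_notMem_tsupport fun h => hm (hsupp m h)]
          positivity
      · rw [← ENNReal.ofReal_natCast, ← ENNReal.ofReal_mul (by positivity)]
        refine ENNReal.ofReal_le_ofReal (le_trans (le_of_eq ?_) hδε)
        push_cast
        ring
  · obtain ⟨r, t, x, hx, hr, hrx, hsub⟩ := exists_cylBox_subset_pcyl hc hK1 hL0 hκ2 hκ (e k)
    exact ⟨r, t, x, hx, hr, hrx, (hsupp _).trans hsub⟩
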